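/- arXiv:2603.13158 — 5 statements merged into one kernel-verified Lean document; each statement's English description precedes it below -/
import Mathlib

section
/- Let F : ℂ → ℂ be differentiable in the real sense and w ∈ ℂ. Then the twisted derivatives commute with the twisted shifts: 𝒟₁(F_w)(z) = (𝒟₁F)_w(z) and 𝒟₂(F_w)(z) = (𝒟₂F)_w(z) for all z ∈ ℂ. -/
open ComplexConjugate

/-- The twisted shift `F_w(z) = F(z+w) · exp(−i·Im(z·conj w))`. -/
noncomputable def twistedShift (F : ℂ → ℂ) (w z : ℂ) : ℂ :=
  F (z + w) * Complex.exp (-Complex.I * ((z * conj w).im : ℂ))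

/-- Partial derivative in the first real coordinate. -/
noncomputable def pdx (F : ℂ → ℂ) (z : ℂ) : ℂ := fderiv ℝ F z 1

/-- Partial derivative in the second real coordinate. -/
noncomputable def pdy (F : ℂ → ℂ) (z : ℂ) : ℂ := fderiv ℝ F z Complex.I

/-- The Wirtinger derivative `∂F = (1/2)(∂ₓF − i·∂_yF)`. -/
noncomputable def wirtD (F : ℂ → ℂ) (z : ℂ) : ℂ :=
  (1 / 2 : ℂ) * (pdx F z - Complex.I * pdy F z)

/-- The Wirtinger derivative `∂̄F = (1/2)(∂ₓF + i·∂_yF)`. -/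
noncomputable def wirtDbar (F : ℂ → ℂ) (z : ℂ) : ℂ :=
  (1 / 2 : ℂ) * (pdx F z + Complex.I * pdy F z)

/-- The twisted derivative `𝒟₁F(z) = ∂F(z) − (conj z / 2)·F(z)`. -/
noncomputable def twistD1 (F : ℂ → ℂ) (z : ℂ) : ℂ :=
  wirtD F z - conj z / 2 * F z

/-- The twisted derivative `𝒟₂F(z) = ∂̄F(z) + (z/2)·F(z)`. -/
noncomputable def twistD2 (F : ℂ → ℂ) (z : ℂ) : ℂ :=
  wirtDbar F z + z / 2 * F z

/-- The product rule for the real derivative of a twisted shift, in the direction `v`. -/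
theorem fderiv_twistedShift_apply {F : ℂ → ℂ} {w z : ℂ} (hF : DifferentiableAt ℝ F (z + w))
    (v : ℂ) :
    fderiv ℝ (twistedShift F w) z v =
      (fderiv ℝ F (z + w) v - Complex.I * ((v * conj w).im : ℂ) * F (z + w)) *
        Complex.exp (-Complex.I * ((z * conj w).im : ℂ)) := by
  let L : ℂ →L[ℝ] ℂ :=
    Complex.ofRealCLM ∘L Complex.imCLM ∘L (ContinuousLinearMap.mul ℝ ℂ).flip (conj w)
  have hL (u : ℂ) : L u = ((u * conj w).im : ℂ) := rfl
  have hshift : HasFDerivAt (fun u : ℂ => F (u + w)) (fderiv ℝ F (z + w)) z :=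
    (hasFDerivAt_comp_add_right w).2 hF.hasFDerivAt
  have hexp := ((L.hasFDerivAt (x := z)).const_mul (-Complex.I)).cexp
  have h := (hshift.fun_mul hexp).fderiv
  have heq : twistedShift F w = fun u => F (u + w) * Complex.exp (-Complex.I * L u) := rfl
  rw [heq, h]
  simp only [add_apply, smul_apply, smul_eq_mul, hL]
  ring

/-- The twisted derivatives commute with the twisted shifts. -/
theorem twistD_comm_twistedShift (F : ℂ → ℂ) (hF : Differentiable ℝ F) (w : ℂ) :
    ∀ z : ℂ,
      twistD1 (twistedShift F w) z = twistedShift (twistD1 F) w z ∧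
      twistD2 (twistedShift F w) z = twistedShift (twistD2 F) w z := by
  intro z
  have h (v : ℂ) := fderiv_twistedShift_apply (w := w) (hF (z + w)) v
  have him : (1 * conj w).im = -w.im := by simp
  have hre : (Complex.I * conj w).im = w.re := by simp
  have hw : w = w.re + w.im * Complex.I := (Complex.re_add_im w).symm
  have hconj : conj w = w.re - w.im * Complex.I := by
    apply Complex.ext <;> simp
  constructor
  · simp only [twistD1, wirtD, pdx, pdy, h, him, hre]
    simp only [twistedShift, twistD1, wirtD, pdx, pdy, map_add, Complex.ofReal_neg]
    linear_combination ((1 / 2 : ℂ) * w.re * Complex.I_sq + (1 / 2 : ℂ) * hconj) * F (z + w) *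
      Complex.exp (-Complex.I * ((z * conj w).im : ℂ))
  · simp only [twistD2, wirtDbar, pdx, pdy, h, him, hre]
    simp only [twistedShift, twistD2, wirtDbar, pdx, pdy, Complex.ofReal_neg]
    linear_combination (-(1 / 2 : ℂ) * w.re * Complex.I_sq - (1 / 2 : ℂ) * hw) * F (z + w) *
      Complex.exp (-Complex.I * ((z * conj w).im : ℂ))
end

section
/- There exists a universal constant C > 0 such that for every L ≥ 1 and every 0 < δ ≤ 1, the sparse grid X_L = { μ ∈ Λ : |μ|_∞ ≤ L and there exists λ ∈ Δ with |μ − λ|_∞ = δ** } is a finite set of cardinality at most C·L²·δ^{−3/2}. -/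
/-- The coarse spacing `δ* = 2·⌈δ^{−1/2}/4⌉·δ`. -/
noncomputable def deltaStar (δ : ℝ) : ℝ := 2 * (⌈(Real.sqrt δ)⁻¹ / 4⌉ : ℤ) * δ

/-- The coarse scale `δ** = ⌈δ^{−1/2}⌉·δ`. -/
noncomputable def deltaSS (δ : ℝ) : ℝ := (⌈(Real.sqrt δ)⁻¹⌉ : ℤ) * δ

/-- The fine grid `Λ = { δk + iδj : k, j ∈ ℤ }`. -/
def fineGrid (δ : ℝ) : Set ℂ :=
  {z : ℂ | ∃ k j : ℤ, z = (δ * k : ℝ) + (δ * j : ℝ) * Complex.I}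

/-- The coarse grid `Δ = { δ*k + iδ*j : k, j ∈ ℤ }`. -/
noncomputable def coarseGrid (δ : ℝ) : Set ℂ :=
  {z : ℂ | ∃ k j : ℤ, z = (deltaStar δ * k : ℝ) + (deltaStar δ * j : ℝ) * Complex.I}

/-- The infinity norm `|u|_∞ = max(|Re u|, |Im u|)`. -/
noncomputable def infNorm (u : ℂ) : ℝ := max |u.re| |u.im|

/-- The sparse grid `X_L`: fine grid points `μ` with `|μ|_∞ ≤ L` lying at
`|·|_∞`-distance exactly `δ**` from some coarse grid point. -/
noncomputable def sparseGrid (δ L : ℝ) : Set ℂ :=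
  {μ ∈ fineGrid δ | infNorm μ ≤ L ∧ ∃ l ∈ coarseGrid δ, infNorm (μ - l) = deltaSS δ}

/-- An integer point `δ * a` at distance `n * δ` from `p * δ * k`, with `|δ * a| ≤ L`, has the form
`a = p * k + e` with `e = ± n` and `|k| ≤ ⌊(⌊L / δ⌋ + n) / p⌋`. -/
lemma exists_offset_of_abs_sub_eq {δ L : ℝ} (hδ : 0 < δ) {n p a k : ℤ} (hp : 0 < p)
    (hn : 0 ≤ n) (ha : |δ * a| ≤ L) (h : |δ * a - p * δ * k| = n * δ) :
    ∃ e ∈ ({n, -n} : Finset ℤ), a = p * k + e ∧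
      k ∈ Finset.Icc (-((⌊L / δ⌋ + n) / p)) ((⌊L / δ⌋ + n) / p) := by
  have habs : |a| ≤ ⌊L / δ⌋ := by
    rw [Int.le_floor, le_div_iff₀ hδ]
    rw [abs_mul, abs_of_pos hδ] at ha
    push_cast
    linarith
  have hdist : |a - p * k| = n := by
    have hr : δ * a - p * δ * k = δ * ((a - p * k : ℤ) : ℝ) := by push_cast; ring
    rw [hr, abs_mul, abs_of_pos hδ, mul_comm] at h
    exact_mod_cast mul_right_cancel₀ hδ.ne' h
  refine ⟨a - p * k, ?_, by ring, ?_⟩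
  · rcases (abs_eq hn).1 hdist with h | h <;> simp [h]
  · have h1 := abs_le.1 habs
    have h2 := abs_le.1 hdist.le
    rw [Finset.mem_Icc, neg_le, Int.le_ediv_iff_mul_le hp, Int.le_ediv_iff_mul_le hp]
    constructor <;> linarith

/-- The number of integers in a symmetric interval. -/
lemma card_Icc_neg_self {K : ℤ} (hK : 0 ≤ K) : ((Finset.Icc (-K) K).card : ℝ) = 2 * K + 1 := by
  have h : ((Finset.Icc (-K) K).card : ℤ) = 2 * K + 1 := by
    rw [Int.card_Icc, Int.toNat_of_nonneg (by linarith)]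
    ring
  exact_mod_cast h

/-- A finite set containing the sparse grid: in one of the two coordinates, the point is at
distance `n` from a multiple of `p`. -/
noncomputable def sparseGridCover (δ : ℝ) (n p K N : ℤ) : Finset ℂ :=
  let S := ({n, -n} : Finset ℤ) ×ˢ Finset.Icc (-K) K ×ˢ Finset.Icc (-N) N
  S.image (fun x => ((δ * (p * x.2.1 + x.1 : ℤ) : ℝ) + (δ * x.2.2 : ℝ) * Complex.I : ℂ)) ∪
    S.image (fun x => ((δ * x.2.2 : ℝ) + (δ * (p * x.2.1 + x.1 : ℤ) : ℝ) * Complex.I : ℂ))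

lemma card_sparseGridCover_le (δ : ℝ) (n p : ℤ) {K N : ℤ} (hK : 0 ≤ K) (hN : 0 ≤ N) :
    ((sparseGridCover δ n p K N).card : ℝ) ≤ 4 * (2 * K + 1) * (2 * N + 1) := by
  rw [← card_Icc_neg_self hK, mul_assoc, ← card_Icc_neg_self hN]
  norm_cast
  set S := ({n, -n} : Finset ℤ) ×ˢ Finset.Icc (-K) K ×ˢ Finset.Icc (-N) N with hS
  have hcard : S.card ≤ 2 * ((Finset.Icc (-K) K).card * (Finset.Icc (-N) N).card) := by
    rw [hS, Finset.card_product, Finset.card_product]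
    exact Nat.mul_le_mul_right _ Finset.card_le_two
  calc (sparseGridCover δ n p K N).card ≤ S.card + S.card :=
        (Finset.card_union_le _ _).trans (add_le_add Finset.card_image_le Finset.card_image_le)
    _ ≤ _ := by linarith

lemma sparseGrid_subset_cover {δ L : ℝ} (hδ : 0 < δ) {n m : ℤ} (hm : 0 < m) (hn : 0 ≤ n)
    (hstar : deltaStar δ = ((2 * m : ℤ) : ℝ) * δ) (hss : deltaSS δ = n * δ) :
    sparseGrid δ L ⊆ sparseGridCover δ n (2 * m) ((⌊L / δ⌋ + n) / (2 * m)) ⌊L / δ⌋ := by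
  rintro μ ⟨⟨a, b, rfl⟩, hL, l, ⟨k, j, rfl⟩, h⟩
  have hp : 0 < 2 * m := by linarith
  rw [hss, hstar] at h
  simp only [infNorm, Complex.sub_re, Complex.sub_im, Complex.add_re, Complex.add_im,
    Complex.re_ofReal_mul, Complex.im_ofReal_mul, Complex.ofReal_re, Complex.ofReal_im,
    Complex.I_re, Complex.I_im, mul_zero, mul_one, add_zero, zero_add] at h hL
  obtain ⟨ha, hb⟩ := max_le_iff.1 hL
  have hmem : ∀ c : ℤ, |δ * c| ≤ L → c ∈ Finset.Icc (-⌊L / δ⌋) ⌊L / δ⌋ := by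
    intro c hc
    rw [Finset.mem_Icc, ← abs_le, Int.le_floor, le_div_iff₀ hδ]
    rw [abs_mul, abs_of_pos hδ] at hc
    push_cast
    linarith
  simp only [sparseGridCover, Finset.coe_union, Finset.coe_image]
  rcases max_choice |δ * (a : ℝ) - ((2 * m : ℤ) : ℝ) * δ * k|
    |δ * (b : ℝ) - ((2 * m : ℤ) : ℝ) * δ * j| with hc | hc
  · obtain ⟨e, he, hae, hk⟩ := exists_offset_of_abs_sub_eq hδ hp hn ha (hc.symm.trans h)
    exact Or.inl ⟨(e, k, b), Finset.mem_product.2 ⟨he, Finset.mem_product.2 ⟨hk, hmem b hb⟩⟩,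
      by rw [hae]⟩
  · obtain ⟨e, he, hbe, hj⟩ := exists_offset_of_abs_sub_eq hδ hp hn hb (hc.symm.trans h)
    exact Or.inr ⟨(e, j, a), Finset.mem_product.2 ⟨he, Finset.mem_product.2 ⟨hj, hmem a ha⟩⟩,
      by rw [hbe]⟩

/-- There is a universal constant `C > 0` such that for all `L ≥ 1` and
`0 < δ ≤ 1`, the sparse grid `X_L` is finite with cardinality at most
`C·L²·δ^{−3/2}`. -/
theorem sparseGrid_card_bound :
    ∃ C : ℝ, 0 < C ∧ ∀ L δ : ℝ, 1 ≤ L → 0 < δ → δ ≤ 1 →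
      (sparseGrid δ L).Finite ∧
        (Nat.card (sparseGrid δ L) : ℝ) ≤ C * L ^ 2 * δ ^ (-(3 : ℝ) / 2) := by
  refine ⟨156, by norm_num, fun L δ hL hδ hδ1 => ?_⟩
  set s := (Real.sqrt δ)⁻¹ with hs
  have hsqrt : 0 < Real.sqrt δ := Real.sqrt_pos.2 hδ
  have hs1 : 1 ≤ s := (one_le_inv₀ hsqrt).2 (Real.sqrt_le_one.2 hδ1)
  have hs0 : 0 < s := by linarith
  have hpow : δ ^ (-(3 : ℝ) / 2) = s ^ 3 := by
    rw [hs, Real.sqrt_eq_rpow, ← Real.rpow_neg hδ.le, ← Real.rpow_natCast, ← Real.rpow_mul hδ.le]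
    norm_num
  have hdiv : L / δ = L * s ^ 2 := by
    rw [hs, inv_pow, Real.sq_sqrt hδ.le, div_eq_mul_inv]
  set m : ℤ := ⌈s / 4⌉ with hm
  set n : ℤ := ⌈s⌉ with hn
  set N : ℤ := ⌊L / δ⌋ with hN
  have hm0 : 0 < m := Int.ceil_pos.2 (by positivity)
  have hn0 : 0 < n := Int.ceil_pos.2 hs0
  have hN0 : 0 ≤ N := Int.floor_nonneg.2 (by positivity)
  have hp0 : 0 < 2 * m := by linarith
  set K : ℤ := (N + n) / (2 * m) with hK
  have hK0 : 0 ≤ K := Int.ediv_nonneg (by linarith) hp0.le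
  have hsub : sparseGrid δ L ⊆ sparseGridCover δ n (2 * m) K N :=
    sparseGrid_subset_cover hδ hm0 hn0.le (by rw [deltaStar]; push_cast; rfl) rfl
  refine ⟨(Finset.finite_toSet _).subset hsub, ?_⟩
  have hNle : (N : ℝ) ≤ L * s ^ 2 := hdiv ▸ Int.floor_le _
  have hnle : (n : ℝ) ≤ 2 * s := by linarith [Int.ceil_lt_add_one s]
  have hmge : s / 4 ≤ (m : ℝ) := Int.le_ceil _
  have hLs : 1 ≤ L * s := one_le_mul_of_one_le_of_one_le hL hs1
  have hLs2 : 1 ≤ L * s ^ 2 := one_le_mul_of_one_le_of_one_le hL (one_le_pow₀ hs1)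
  have hKle : (K : ℝ) ≤ 6 * (L * s) := by
    have h1 : (K : ℝ) * (2 * m) ≤ N + n := by exact_mod_cast Int.ediv_mul_le (N + n) hp0.ne'
    have h2 : (K : ℝ) * (s / 2) ≤ K * (2 * m) :=
      mul_le_mul_of_nonneg_left (by linarith) (by exact_mod_cast hK0)
    have h3 : s ≤ L * s ^ 2 := by nlinarith
    refine le_of_mul_le_mul_right (a := s / 2) ?_ (by positivity)
    nlinarith
  have hcard : Nat.card (sparseGrid δ L) ≤ (sparseGridCover δ n (2 * m) K N).card := by
    rw [Nat.card_coe_set_eq, ← Set.ncard_coe_finset]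
    exact Set.ncard_le_ncard hsub (Finset.finite_toSet _)
  calc (Nat.card (sparseGrid δ L) : ℝ) ≤ (sparseGridCover δ n (2 * m) K N).card := by
        exact_mod_cast hcard
    _ ≤ 4 * (2 * K + 1) * (2 * N + 1) := card_sparseGridCover_le δ n _ hK0 hN0
    _ ≤ 4 * (13 * (L * s)) * (3 * (L * s ^ 2)) := by
        have : (0 : ℝ) ≤ N := by exact_mod_cast hN0
        gcongr <;> linarith
    _ = 156 * L ^ 2 * δ ^ (-(3 : ℝ) / 2) := by rw [hpow]; ring
end

section
/- Let τ ∈ ℂ with τ ≠ 0, and let α : [a, b] → ℂ be continuously differentiable with Re(conj(τ)·α(t)) > 0 for all t ∈ [a, b]. Then Im ∫ₐᵇ α'(t)/α(t) dt = arg(α(b)·conj(α(a))), where arg : ℂ \ {0} → (−π, π] is the principal branch of the argument. -/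
open ComplexConjugate

/-- If `z` and `w` lie in the open right half-plane, then the argument of `z * conj w` is the
difference of their arguments. -/
theorem Complex.arg_mul_conj_of_re_pos {z w : ℂ} (hz : 0 < z.re) (hw : 0 < w.re) :
    (z * conj w).arg = z.arg - w.arg := by
  have hz' := abs_lt.mp (Complex.abs_arg_lt_pi_div_two_iff.mpr (Or.inl hz))
  have hw' := abs_lt.mp (Complex.abs_arg_lt_pi_div_two_iff.mpr (Or.inl hw))
  have hz0 : z ≠ 0 := by rintro rfl; simp at hz
  have hw0 : w ≠ 0 := by rintro rfl; simp at hw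
  have hc : (conj w).arg = -w.arg := by
    rw [Complex.arg_conj, if_neg (by linarith [Real.pi_pos])]
  rw [Complex.arg_mul hz0 (by simpa using hw0), hc, sub_eq_add_neg]
  rw [hc]
  constructor <;> linarith

/-- Unproblematic calculation of argument change: if `Re(conj τ · α(t)) > 0`
along a continuously differentiable curve `α : [a,b] → ℂ`, then the imaginary
part of `∫ α'/α` equals `arg(α(b)·conj(α(a)))` (principal branch). -/
theorem arg_change_of_halfplane (τ : ℂ) (hτ : τ ≠ 0) (a b : ℝ) (hab : a ≤ b)
    (α : ℝ → ℂ) (hα : ContDiffOn ℝ 1 α (Set.Icc a b))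
    (hpos : ∀ t ∈ Set.Icc a b, 0 < (conj τ * α t).re) :
    (∫ t in a..b, derivWithin α (Set.Icc a b) t / α t).im =
      Complex.arg (α b * conj (α a)) := by
  set c : ℂ := conj τ with hc
  have hc0 : c ≠ 0 := by simpa [hc] using hτ
  have hα0 : ∀ t ∈ Set.Icc a b, α t ≠ 0 := fun t ht h => by simpa [h] using hpos t ht
  have harg : Complex.arg (α b * conj (α a)) = (c * α b).arg - (c * α a).arg := by
    rw [← Complex.arg_mul_conj_of_re_pos (hpos b (Set.right_mem_Icc.mpr hab))
      (hpos a (Set.left_mem_Icc.mpr hab)), ← Complex.arg_real_mul (α b * conj (α a))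
      (Complex.normSq_pos.mpr hc0), ← Complex.mul_conj, map_mul]
    congr 1
    ring
  rw [harg]
  rcases hab.eq_or_lt with rfl | hlt
  · simp
  have hud := uniqueDiffOn_Icc hlt
  have hcont : ContinuousOn (fun t => Complex.log (c * α t)) (Set.Icc a b) :=
    (continuousOn_const.mul hα.continuousOn).clog fun t ht => Or.inl (hpos t ht)
  have hint : IntervalIntegrable (fun t => derivWithin α (Set.Icc a b) t / α t)
      MeasureTheory.volume a b :=
    ContinuousOn.intervalIntegrable_of_Icc hab
      ((hα.continuousOn_derivWithin hud le_rfl).div hα.continuousOn hα0)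
  have hderiv : ∀ t ∈ Set.Ioo a b, HasDerivAt (fun t => Complex.log (c * α t))
      (derivWithin α (Set.Icc a b) t / α t) t := fun t ht => by
    have ht' := Set.Ioo_subset_Icc_self ht
    have hd := ((hα.differentiableOn one_ne_zero t ht').hasDerivWithinAt).hasDerivAt
      (Icc_mem_nhds ht.1 ht.2)
    have hlog := (hd.const_mul c).clog_real (Or.inl (hpos t ht'))
    rwa [mul_div_mul_left _ _ hc0] at hlog
  rw [intervalIntegral.integral_eq_sub_of_hasDerivAt_of_le hab hcont hderiv hint,
    Complex.sub_im, Complex.log_im, Complex.log_im]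
end

section
/- Let G, G̃ : ℂ → ℂ be continuously differentiable in the real sense and let φ, ψ : ℂ → ℂ be continuous. Suppose that ∂G = φ·G, ∂̄G = ψ·G, ∂G̃ = φ·G̃ and ∂̄G̃ = ψ·G̃ on all of ℂ, that G̃ is nowhere vanishing, and that G(0) = G̃(0). Then G(z) = G̃(z) for all z ∈ ℂ. -/
open ComplexConjugate

/-- The real derivative of `F` in terms of its Wirtinger derivatives. -/
theorem fderiv_apply_eq_wirtD_add_wirtDbar (F : ℂ → ℂ) (z v : ℂ) :
    fderiv ℝ F z v = wirtD F z * v + wirtDbar F z * conj v := by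
  have hv : v = v.re • (1 : ℂ) + v.im • Complex.I := by
    simp [Complex.re_add_im]
  have hL : fderiv ℝ F z v = v.re * pdx F z + v.im * pdy F z := by
    conv_lhs => rw [hv]
    rw [map_add, map_smul, map_smul, Complex.real_smul, Complex.real_smul, pdx, pdy]
  have hc : conj v = v.re - v.im * Complex.I := by
    apply Complex.ext <;> simp
  rw [hL, hc, wirtD, wirtDbar]
  conv_rhs => rw [← Complex.re_add_im v]
  simp only [Complex.add_re, Complex.add_im, Complex.ofReal_re, Complex.ofReal_im, Complex.mul_re,
    Complex.mul_im, Complex.I_re, Complex.I_im]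
  push_cast
  ring_nf
  simp only [Complex.I_sq]
  ring

/-- Uniqueness for the first-order system `∂G = φ·G`, `∂̄G = ψ·G`: two `C¹`
solutions with the same value at `0`, one of which is nowhere vanishing,
agree everywhere. -/
theorem pde_uniqueness (G Gt : ℂ → ℂ) (φ ψ : ℂ → ℂ)
    (hG : ContDiff ℝ 1 G) (hGt : ContDiff ℝ 1 Gt)
    (hφ : Continuous φ) (hψ : Continuous ψ)
    (h1 : ∀ z : ℂ, wirtD G z = φ z * G z)
    (h2 : ∀ z : ℂ, wirtDbar G z = ψ z * G z)
    (h3 : ∀ z : ℂ, wirtD Gt z = φ z * Gt z)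
    (h4 : ∀ z : ℂ, wirtDbar Gt z = ψ z * Gt z)
    (hnv : ∀ z : ℂ, Gt z ≠ 0) (h0 : G 0 = Gt 0) :
    ∀ z : ℂ, G z = Gt z := by
  have hquot : ∀ z, HasFDerivAt (fun w ↦ G w / Gt w) (0 : ℂ →L[ℝ] ℂ) z := by
    intro z
    have hGz := (hG.differentiable one_ne_zero z).hasFDerivAt
    have hGtz := (hGt.differentiable one_ne_zero z).hasFDerivAt
    have hinv := ((hasDerivAt_inv (hnv z)).hasFDerivAt.restrictScalars ℝ).comp z hGtz
    refine (hGz.fun_mul hinv).congr_fderiv ?_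
    ext1 v
    have hne := hnv z
    simp [fderiv_apply_eq_wirtD_add_wirtDbar, h1, h2, h3, h4]
    field_simp
    ring
  intro z
  have hz := is_const_of_fderiv_eq_zero (fun w ↦ (hquot w).differentiableAt)
    (fun w ↦ (hquot w).fderiv) z 0
  simp only [h0, div_self (hnv 0)] at hz
  exact (div_eq_one_iff_eq (hnv z)).mp hz
end

section
/- Let d > 0 and r ∈ ℝ with 0 < r ≤ d. Let A, B ⊆ ℂ be sets such that: (i) for every a ∈ A there exists b ∈ B with |a − b|_∞ ≤ r; (ii) for every b ∈ B there exists a ∈ A with |a − b|_∞ ≤ d; (iii) A is 7d-separated, i.e., |a − a'|_∞ ≥ 7d for all distinct a, a' ∈ A. Let Z ⊆ B be 5d-separated (|z − z'|_∞ ≥ 5d for all distinct z, z' ∈ Z) and maximal with this property among subsets of B (no strictly larger subset of B containing Z is 5d-separated). Then for every a ∈ A there exists z ∈ Z with |a − z|_∞ ≤ d; moreover, any map Φ : A → Z satisfying |Φ(a) − a|_∞ ≤ d for all a ∈ A is injective. -/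
theorem infNorm_zero : infNorm 0 = 0 := by simp [infNorm]

theorem infNorm_sub_comm (u v : ℂ) : infNorm (u - v) = infNorm (v - u) := by
  simp only [infNorm, Complex.sub_re, Complex.sub_im, abs_sub_comm]

theorem infNorm_sub_le (u v w : ℂ) :
    infNorm (u - w) ≤ infNorm (u - v) + infNorm (v - w) := by
  simp only [infNorm, Complex.sub_re, Complex.sub_im]
  exact max_le
    ((abs_sub_le _ _ _).trans (add_le_add (le_max_left _ _) (le_max_left _ _)))
    ((abs_sub_le _ _ _).trans (add_le_add (le_max_right _ _) (le_max_right _ _)))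

/-- A maximal `t`-separated subset `Z` of `B` meets the open `t`-neighbourhood
of every point of `B`. -/
theorem exists_infNorm_sub_lt_of_maximal_separated {t : ℝ} (ht : 0 < t) {B Z : Set ℂ}
    (hZB : Z ⊆ B)
    (hZsep : ∀ z ∈ Z, ∀ z' ∈ Z, z ≠ z' → t ≤ infNorm (z - z'))
    (hZmax : ∀ Z' : Set ℂ, Z ⊆ Z' → Z' ⊆ B →
      (∀ z ∈ Z', ∀ z' ∈ Z', z ≠ z' → t ≤ infNorm (z - z')) → Z' = Z)
    {b : ℂ} (hb : b ∈ B) : ∃ z ∈ Z, infNorm (b - z) < t := by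
  by_contra! h
  have hins : insert b Z = Z := by
    refine hZmax _ (Set.subset_insert b Z) (Set.insert_subset hb hZB) ?_
    rintro z (rfl | hz) z' (rfl | hz') hne
    · exact absurd rfl hne
    · exact h z' hz'
    · exact infNorm_sub_comm z' z ▸ h z hz
    · exact hZsep z hz z' hz' hne
  have hbb := h b (hins ▸ Set.mem_insert b Z)
  rw [sub_self, infNorm_zero] at hbb
  exact ht.not_ge hbb

/-- Sieving lemma: if every point of `A` lies within `r ≤ d` of `B`, every
point of `B` lies within `d` of `A`, `A` is `7d`-separated, and `Z ⊆ B` is a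
maximal `5d`-separated subset of `B`, then every point of `A` lies within `d`
of `Z`, and any map `Φ : A → Z` moving points at most `d` is injective on `A`. -/
theorem sieving_lemma (d r : ℝ) (hd : 0 < d) (hr : 0 < r) (hrd : r ≤ d)
    (A B Z : Set ℂ)
    (hAB : ∀ a ∈ A, ∃ b ∈ B, infNorm (a - b) ≤ r)
    (hBA : ∀ b ∈ B, ∃ a ∈ A, infNorm (a - b) ≤ d)
    (hAsep : ∀ a ∈ A, ∀ a' ∈ A, a ≠ a' → 7 * d ≤ infNorm (a - a'))
    (hZB : Z ⊆ B)
    (hZsep : ∀ z ∈ Z, ∀ z' ∈ Z, z ≠ z' → 5 * d ≤ infNorm (z - z'))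
    (hZmax : ∀ Z' : Set ℂ, Z ⊆ Z' → Z' ⊆ B →
      (∀ z ∈ Z', ∀ z' ∈ Z', z ≠ z' → 5 * d ≤ infNorm (z - z')) → Z' = Z) :
    (∀ a ∈ A, ∃ z ∈ Z, infNorm (a - z) ≤ d) ∧
      ∀ Φ : ℂ → ℂ, Set.MapsTo Φ A Z →
        (∀ a ∈ A, infNorm (Φ a - a) ≤ d) → Set.InjOn Φ A := by
  constructor
  · intro a ha
    obtain ⟨b, hb, hab⟩ := hAB a ha
    obtain ⟨z, hz, hbz⟩ :=
      exists_infNorm_sub_lt_of_maximal_separated (by positivity) hZB hZsep hZmax hb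
    obtain ⟨a', ha', haz⟩ := hBA z (hZB hz)
    have haa : a = a' := by
      by_contra hne
      have hsep := hAsep a ha a' ha' hne
      have h₁ := infNorm_sub_le a b a'
      have h₂ := infNorm_sub_le b z a'
      rw [infNorm_sub_comm z a'] at h₂
      linarith
    exact ⟨z, hz, haa ▸ haz⟩
  · intro Φ _ hΦ a ha a' ha' heq
    by_contra hne
    have hsep := hAsep a ha a' ha' hne
    have h₁ := infNorm_sub_le a (Φ a) a'
    have h₂ := hΦ a ha
    have h₃ := hΦ a' ha'
    rw [infNorm_sub_comm a (Φ a), heq] at h₁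
    rw [heq] at h₂
    linarith
end
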